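/- Let λ_1, λ_2, θ ∈ ℕ with θ ≤ λ_1. Then, in the field ℚ(q, t) of rational functions, C_θ(q^{-λ_1}t^{-2}, q^{-λ_1-λ_2}t^{-3}; 1, λ_1) = t^θ · (1/t;q)_θ/(q;q)_θ · (q^{λ_1};1/q)_θ/(tq^{λ_1-1};1/q)_θ · (q^{λ_2};1/q)_θ/(tq^{λ_2-1};1/q)_θ · (t³q^{λ_1+λ_2-1};1/q)_θ/(t²q^{λ_1+λ_2-1};1/q)_θ · (1-t³q^{λ_1+λ_2-2θ})/(1-t³q^{λ_1+λ_2-θ}). -/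

import Mathlib

open Finset

/-- The `q`-shifted factorial `(a;q)_m` for an integer index `m`. -/
noncomputable def qPoch {K : Type*} [Field K] (a q : K) (m : ℤ) : K :=
  if 0 ≤ m then ∏ j ∈ Finset.range m.toNat, (1 - a * q ^ j)
  else (∏ j ∈ Finset.range (-m).toNat, (1 - a * q ^ (-(j : ℤ) - 1)))⁻¹

noncomputable abbrev KQT : Type := FractionRing (MvPolynomial (Fin 2) ℚ)

noncomputable def qq : KQT := algebraMap (MvPolynomial (Fin 2) ℚ) KQT (MvPolynomial.X 0)
noncomputable def tt : KQT := algebraMap (MvPolynomial (Fin 2) ℚ) KQT (MvPolynomial.X 1)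

/-- The coefficient `C_θ(u₀,u₁;1,r)` for the root system `A₂` (case `k = 1`),
where `v₁ = q^θ u₁`. -/
noncomputable def Ck1 (u₀ u₁ : KQT) (r θ : ℕ) : KQT :=
  qq ^ θ * (qPoch (tt ^ 2 * u₀) qq θ / qPoch (qq * tt * u₀) qq θ) *
    (qPoch (qq / tt) qq θ / qPoch qq qq θ) *
    (qPoch (qq * u₁) qq θ / qPoch (qq * tt * u₁) qq θ) *
    (qPoch (tt * u₁ / u₀) qq θ / qPoch (qq * u₁ / u₀) qq θ) *
    (1 - (1 - tt * (qq ^ θ * u₁)) / (1 - qq ^ θ * u₁) *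
      ((qq ^ θ * u₁ - u₁) / (qq ^ θ * u₁ - tt * u₁)))

section QPoch

variable {K : Type*} [Field K]

lemma qPoch_natCast (a q : K) (n : ℕ) :
    qPoch a q (n : ℤ) = ∏ j ∈ Finset.range n, (1 - a * q ^ j) := by
  simp [qPoch]

/-- Inverting the base and the arguments in a quotient of two `q`-shifted factorials. -/
lemma qPoch_inv_div_qPoch_inv {c d q : K} (hc : c ≠ 0) (hd : d ≠ 0) (hq : q ≠ 0) (n : ℕ) :
    qPoch c⁻¹ q n / qPoch d⁻¹ q n = (d / c) ^ n * (qPoch c q⁻¹ n / qPoch d q⁻¹ n) := by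
  simp only [qPoch_natCast, ← Finset.prod_div_distrib]
  rw [← Finset.card_range n, ← Finset.prod_const, Finset.card_range, ← Finset.prod_mul_distrib]
  refine Finset.prod_congr rfl fun j _ => ?_
  have hflip : ∀ e : K, e ≠ 0 → 1 - e⁻¹ * q ^ j = -(q ^ j / e) * (1 - e * q⁻¹ ^ j) := by
    intro e he
    rw [inv_pow]
    field_simp
    ring
  have hratio : -(q ^ j / c) / -(q ^ j / d) = d / c := by
    field_simp
  rw [hflip c hc, hflip d hd, mul_div_mul_comm, hratio]

lemma qPoch_mul_base (a q : K) (n : ℕ) :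
    (1 - a) * qPoch (q * a) q n = qPoch a q n * (1 - a * q ^ n) := by
  simp only [qPoch_natCast]
  rw [← Finset.prod_range_succ, Finset.prod_range_succ', mul_comm]
  congr 1
  · exact Finset.prod_congr rfl fun j _ => by ring
  · simp

end QPoch

lemma qq_ne_zero : qq ≠ 0 := by
  simp [qq]

lemma tt_ne_zero : tt ≠ 0 := by
  simp [tt]

lemma tt_pow_mul_qq_pow_ne {m : ℕ} (hm : m ≠ 0) (k l : ℕ) : tt ^ m * qq ^ k ≠ qq ^ l := by
  intro h
  simp only [qq, tt, ← map_pow, ← map_mul] at h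
  have h' := congrArg (MvPolynomial.eval ![(1 : ℚ), 2])
    (IsFractionRing.injective (MvPolynomial (Fin 2) ℚ) KQT h)
  simp only [map_mul, map_pow, MvPolynomial.eval_X, Matrix.cons_val_zero, Matrix.cons_val_one,
    one_pow, mul_one] at h'
  exact (one_lt_pow₀ (by norm_num : (1 : ℚ) < 2) hm).ne' h'

lemma tt_pow_mul_qq_zpow_ne_one {m : ℕ} (hm : m ≠ 0) (n : ℤ) : tt ^ m * qq ^ n ≠ 1 := by
  intro h
  apply tt_pow_mul_qq_pow_ne hm n.toNat (-n).toNat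
  rw [← zpow_natCast qq, ← zpow_natCast qq, ← one_mul (qq ^ ((-n).toNat : ℤ)), ← h, mul_assoc,
    ← zpow_add₀ qq_ne_zero]
  congr 2
  omega

/-- The elementary factor of `Ck1` in closed form, with `v = x * u` and `x = q ^ θ`. -/
lemma one_sub_div_mul_div {K : Type*} [Field K] {t u x : K} (hu : u ≠ 0) (hv : 1 - x * u ≠ 0)
    (hx : x - t ≠ 0) :
    1 - (1 - t * (x * u)) / (1 - x * u) * ((x * u - u) / (x * u - t * u)) =
      (1 - t) * (1 - x ^ 2 * u) / ((1 - x * u) * (x - t)) := by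
  have h : (x * u - u) / (x * u - t * u) = (x - 1) / (x - t) := by
    rw [← sub_mul, ← sub_one_mul, mul_div_mul_right _ _ hu]
  rw [h]
  field_simp
  ring

theorem stmt_7 (lam₁ lam₂ θ : ℕ) (hθ : θ ≤ lam₁) :
    Ck1 (qq ^ (-(lam₁ : ℤ)) * tt ^ (-2 : ℤ))
        (qq ^ (-(lam₁ : ℤ) - lam₂) * tt ^ (-3 : ℤ)) lam₁ θ =
      tt ^ θ * (qPoch tt⁻¹ qq θ / qPoch qq qq θ) *
        (qPoch (qq ^ (lam₁ : ℤ)) qq⁻¹ θ / qPoch (tt * qq ^ ((lam₁ : ℤ) - 1)) qq⁻¹ θ) *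
        (qPoch (qq ^ (lam₂ : ℤ)) qq⁻¹ θ / qPoch (tt * qq ^ ((lam₂ : ℤ) - 1)) qq⁻¹ θ) *
        (qPoch (tt ^ 3 * qq ^ ((lam₁ : ℤ) + lam₂ - 1)) qq⁻¹ θ /
          qPoch (tt ^ 2 * qq ^ ((lam₁ : ℤ) + lam₂ - 1)) qq⁻¹ θ) *
        ((1 - tt ^ 3 * qq ^ ((lam₁ : ℤ) + lam₂ - 2 * θ)) /
          (1 - tt ^ 3 * qq ^ ((lam₁ : ℤ) + lam₂ - θ))) := by
  have hq := qq_ne_zero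
  have ht := tt_ne_zero
  have ht1 : 1 - tt⁻¹ ≠ 0 := by
    have h := tt_pow_mul_qq_zpow_ne_one one_ne_zero 0
    rw [pow_one, zpow_zero, mul_one] at h
    exact sub_ne_zero.2 fun h' => h (inv_eq_one.1 h'.symm)
  have hxt : qq ^ θ - tt ≠ 0 := by
    have h := tt_pow_mul_qq_pow_ne one_ne_zero 0 θ
    rw [pow_one, pow_zero, mul_one] at h
    exact sub_ne_zero.2 h.symm
  have hw := tt_pow_mul_qq_zpow_ne_one three_ne_zero ((lam₁ : ℤ) + lam₂ - θ)
  have hbase : qPoch (qq / tt) qq θ = qPoch tt⁻¹ qq θ * (1 - tt⁻¹ * qq ^ θ) / (1 - tt⁻¹) := by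
    rw [eq_div_iff ht1, ← qPoch_mul_base, mul_comm, div_eq_mul_inv]
  have e1 : tt ^ 2 * (qq ^ (-(lam₁ : ℤ)) * tt ^ (-2 : ℤ)) = (qq ^ (lam₁ : ℤ))⁻¹ := by
    rw [zpow_neg, zpow_neg]
    field_simp
  have e2 : qq * tt * (qq ^ (-(lam₁ : ℤ)) * tt ^ (-2 : ℤ)) =
      (tt * qq ^ ((lam₁ : ℤ) - 1))⁻¹ := by
    rw [zpow_sub_one₀ hq, zpow_neg, zpow_neg, zpow_ofNat]
    field_simp
  have e3 : qq * (qq ^ (-(lam₁ : ℤ) - lam₂) * tt ^ (-3 : ℤ)) =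
      (tt ^ 3 * qq ^ ((lam₁ : ℤ) + lam₂ - 1))⁻¹ := by
    rw [← neg_add', zpow_sub_one₀ hq, zpow_neg, zpow_neg, zpow_ofNat]
    field_simp
  have e4 : qq * tt * (qq ^ (-(lam₁ : ℤ) - lam₂) * tt ^ (-3 : ℤ)) =
      (tt ^ 2 * qq ^ ((lam₁ : ℤ) + lam₂ - 1))⁻¹ := by
    rw [← neg_add', zpow_sub_one₀ hq, zpow_neg, zpow_neg, zpow_ofNat]
    field_simp
  have hquot : qq ^ (-(lam₁ : ℤ) - lam₂) * tt ^ (-3 : ℤ) / (qq ^ (-(lam₁ : ℤ)) * tt ^ (-2 : ℤ)) =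
      (tt * qq ^ (lam₂ : ℤ))⁻¹ := by
    rw [zpow_sub₀ hq, zpow_neg, zpow_neg, zpow_neg, zpow_ofNat, zpow_ofNat]
    field_simp
  have e5 : tt * (qq ^ (-(lam₁ : ℤ) - lam₂) * tt ^ (-3 : ℤ)) /
      (qq ^ (-(lam₁ : ℤ)) * tt ^ (-2 : ℤ)) = (qq ^ (lam₂ : ℤ))⁻¹ := by
    rw [mul_div_assoc, hquot]
    field_simp
  have e6 : qq * (qq ^ (-(lam₁ : ℤ) - lam₂) * tt ^ (-3 : ℤ)) /
      (qq ^ (-(lam₁ : ℤ)) * tt ^ (-2 : ℤ)) = (tt * qq ^ ((lam₂ : ℤ) - 1))⁻¹ := by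
    rw [mul_div_assoc, hquot, zpow_sub_one₀ hq]
    field_simp
  have hv : qq ^ θ * (qq ^ (-(lam₁ : ℤ) - lam₂) * tt ^ (-3 : ℤ)) =
      (tt ^ 3 * qq ^ ((lam₁ : ℤ) + lam₂ - θ))⁻¹ := by
    rw [← neg_add', zpow_sub₀ hq, zpow_neg, zpow_neg, zpow_ofNat, zpow_natCast]
    field_simp
  have hv2 : (qq ^ θ) ^ 2 * (qq ^ (-(lam₁ : ℤ) - lam₂) * tt ^ (-3 : ℤ)) =
      qq ^ θ * (tt ^ 3 * qq ^ ((lam₁ : ℤ) + lam₂ - θ))⁻¹ := by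
    rw [← hv]
    ring
  have hw2 : tt ^ 3 * qq ^ ((lam₁ : ℤ) + lam₂ - 2 * θ) =
      tt ^ 3 * qq ^ ((lam₁ : ℤ) + lam₂ - θ) / qq ^ θ := by
    rw [mul_div_assoc, ← zpow_natCast qq θ, ← zpow_sub₀ hq]
    congr 2
    ring
  have hu : qq ^ (-(lam₁ : ℤ) - lam₂) * tt ^ (-3 : ℤ) ≠ 0 :=
    mul_ne_zero (zpow_ne_zero _ hq) (zpow_ne_zero _ ht)
  have hw0 : tt ^ 3 * qq ^ ((lam₁ : ℤ) + lam₂ - θ) ≠ 0 :=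
    mul_ne_zero (pow_ne_zero _ ht) (zpow_ne_zero _ hq)
  have hv1 : 1 - qq ^ θ * (qq ^ (-(lam₁ : ℤ) - lam₂) * tt ^ (-3 : ℤ)) ≠ 0 := by
    rw [hv]
    exact sub_ne_zero.2 fun h => hw (inv_eq_one.1 h.symm)
  rw [Ck1, one_sub_div_mul_div hu hv1 hxt, hv2, hv, e6, e5, e1, e2, e3, e4, hbase, hw2]
  rw [qPoch_inv_div_qPoch_inv (zpow_ne_zero _ hq) (mul_ne_zero ht (zpow_ne_zero _ hq)) hq,
    qPoch_inv_div_qPoch_inv (zpow_ne_zero _ hq) (mul_ne_zero ht (zpow_ne_zero _ hq)) hq,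
    qPoch_inv_div_qPoch_inv (mul_ne_zero (pow_ne_zero _ ht) (zpow_ne_zero _ hq))
      (mul_ne_zero (pow_ne_zero _ ht) (zpow_ne_zero _ hq)) hq]
  have r1 : ∀ n : ℤ, tt * qq ^ (n - 1) / qq ^ n = tt / qq := by
    intro n
    rw [zpow_sub_one₀ hq]
    field_simp
  have r2 : ∀ n : ℤ, tt ^ 2 * qq ^ n / (tt ^ 3 * qq ^ n) = tt⁻¹ := by
    intro n
    field_simp
  rw [r1, r1, r2]
  generalize tt ^ 3 * qq ^ ((lam₁ : ℤ) + lam₂ - θ) = w at *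
  have hfactor : (1 - tt⁻¹ * qq ^ θ) / (1 - tt⁻¹) *
      ((1 - tt) * (1 - qq ^ θ * w⁻¹) / ((1 - w⁻¹) * (qq ^ θ - tt))) =
      qq ^ θ * ((1 - w / qq ^ θ) / (1 - w)) := by
    have h1 : tt - 1 ≠ 0 := fun h => ht1 (by rw [sub_eq_zero.1 h]; simp)
    have h2 : w - 1 ≠ 0 := sub_ne_zero.2 hw
    have h3 : 1 - w ≠ 0 := sub_ne_zero.2 hw.symm
    field_simp
    ring
  have hpow : qq ^ θ * (tt / qq) ^ θ * (tt / qq) ^ θ * tt⁻¹ ^ θ * qq ^ θ = tt ^ θ := by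
    simp only [← mul_pow]
    congr 1
    field_simp
  generalize (1 - w / qq ^ θ) / (1 - w) = F at *
  generalize (1 - tt) * (1 - qq ^ θ * w⁻¹) / ((1 - w⁻¹) * (qq ^ θ - tt)) = G at *
  rw [mul_div_assoc (qPoch tt⁻¹ qq θ)]
  generalize (1 - tt⁻¹ * qq ^ θ) / (1 - tt⁻¹) = H at *
  rw [← hpow]
  linear_combination (qq ^ θ * (tt / qq) ^ θ * (tt / qq) ^ θ * tt⁻¹ ^ θ *
    (qPoch tt⁻¹ qq θ / qPoch qq qq θ) *
    (qPoch (qq ^ (lam₁ : ℤ)) qq⁻¹ θ / qPoch (tt * qq ^ ((lam₁ : ℤ) - 1)) qq⁻¹ θ) *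
    (qPoch (qq ^ (lam₂ : ℤ)) qq⁻¹ θ / qPoch (tt * qq ^ ((lam₂ : ℤ) - 1)) qq⁻¹ θ) *
    (qPoch (tt ^ 3 * qq ^ ((lam₁ : ℤ) + lam₂ - 1)) qq⁻¹ θ /
      qPoch (tt ^ 2 * qq ^ ((lam₁ : ℤ) + lam₂ - 1)) qq⁻¹ θ)) * hfactor
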